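/- For every real α ∈ (0,1), one has limsup_{n→∞} log(e_{⌊n^α⌋}(n))/log(n) ≥ 1 − α. -/

import Mathlib

open Filter

/-- A finite subset `S` of the `n`-dimensional hypercube (binary sequences of
length `n`) is `d`-equilateral if it is nonempty and any two distinct points
have Hamming distance exactly `d`. -/
def IsEquilateralSet {n : ℕ} (d : ℕ) (S : Finset (Fin n → Bool)) : Prop :=
  S.Nonempty ∧ ∀ x ∈ S, ∀ y ∈ S, x ≠ y → hammingDist x y = d

/-- `equilateralDim d n` is the maximal size of a `d`-equilateral subset of the
`n`-dimensional hypercube. -/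
noncomputable def equilateralDim (d n : ℕ) : ℕ :=
  sSup {m : ℕ | ∃ S : Finset (Fin n → Bool), IsEquilateralSet d S ∧ S.card = m}

/-- For `d > 0`, a `d`-equilateral subset of the `n`-cube has at most `n + 1` points: the functions
`y ↦ d - hammingDist x y` lie in the span of `1` and the coordinates, and restrict to a multiple of
the standard basis of the functions on the set. -/
lemma IsEquilateralSet.card_le {n d : ℕ} (hd : 0 < d) {S : Finset (Fin n → Bool)}
    (hS : IsEquilateralSet d S) : S.card ≤ n + 1 := by
  classical
  let T : (Option (Fin n) → ℝ) →ₗ[ℝ] (S → ℝ) :=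
    { toFun := fun c y => c none + ∑ i, c (some i) * (if y.1 i then 1 else 0)
      map_add' := by
        intro a b
        ext y
        simp only [Pi.add_apply, add_mul, Finset.sum_add_distrib]
        ring
      map_smul' := by
        intro r a
        ext y
        simp only [Pi.smul_apply, smul_eq_mul, RingHom.id_apply, mul_add, Finset.mul_sum,
          mul_assoc] }
  have hdist (x y : Fin n → Bool) : (hammingDist x y : ℝ) =
      (∑ i, if x i then (1 : ℝ) else 0) +
        ∑ i, (if x i then (-1 : ℝ) else 1) * (if y i then 1 else 0) := by
    rw [hammingDist, Finset.card_filter, ← Finset.sum_add_distrib]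
    push_cast
    refine Finset.sum_congr rfl fun i _ => ?_
    cases x i <;> cases y i <;> simp
  have hbasis (x : S) : ∃ c, T c = Pi.single x 1 := by
    have hd' : (d : ℝ) ≠ 0 := by positivity
    refine ⟨(d : ℝ)⁻¹ • (fun o => o.elim (d - ∑ i, if x.1 i then (1 : ℝ) else 0)
      (fun i => - if x.1 i then (-1 : ℝ) else 1)), ?_⟩
    rw [map_smul]
    ext y
    have key : T (fun o => o.elim (d - ∑ i, if x.1 i then (1 : ℝ) else 0)
        (fun i => - if x.1 i then (-1 : ℝ) else 1)) y = d - hammingDist x.1 y.1 := by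
      rw [hdist]
      simp only [T, LinearMap.coe_mk, AddHom.coe_mk, Option.elim, neg_mul,
        Finset.sum_neg_distrib]
      ring
    rw [Pi.smul_apply, key, smul_eq_mul]
    by_cases hxy : y = x
    · subst hxy
      simp [hd']
    · rw [hS.2 x x.2 y y.2 fun h => hxy (Subtype.ext h.symm)]
      simp [hxy]
  have hsurj : Function.Surjective T := by
    choose c hc using hbasis
    intro f
    refine ⟨∑ x, f x • c x, ?_⟩
    ext y
    simp [map_sum, hc, Pi.single_apply]
  simpa using LinearMap.finrank_le_finrank_of_surjective hsurj

lemma equilateralDim_le {d n : ℕ} (hd : 0 < d) : equilateralDim d n ≤ n + 1 := by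
  refine csSup_le' ?_
  rintro m ⟨S, hS, rfl⟩
  exact hS.card_le hd

lemma IsEquilateralSet.card_le_equilateralDim {d n : ℕ} (hd : 0 < d)
    {S : Finset (Fin n → Bool)} (hS : IsEquilateralSet d S) : S.card ≤ equilateralDim d n := by
  refine le_csSup ⟨n + 1, ?_⟩ ⟨S, hS, rfl⟩
  rintro m ⟨S, hS, rfl⟩
  exact hS.card_le hd

lemma card_filter_div_eq {n h j : ℕ} (hh : 0 < h) (hj : j < n / h) :
    (Finset.univ.filter fun i : Fin n => i.val / h = j).card = h := by
  have hmap : (Finset.univ.filter fun i : Fin n => i.val / h = j).map Fin.valEmbedding =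
      Finset.Ico (j * h) ((j + 1) * h) := by
    ext a
    have hle : (j + 1) * h ≤ n := (Nat.le_div_iff_mul_le hh).1 hj
    simp only [Finset.mem_map, Finset.mem_filter, Finset.mem_univ, true_and,
      Fin.valEmbedding_apply, Finset.mem_Ico]
    have hdiv : a / h = j ↔ j * h ≤ a ∧ a < (j + 1) * h := by
      rw [← Nat.le_div_iff_mul_le hh, ← Nat.div_lt_iff_lt_mul hh]
      omega
    rw [← hdiv]
    constructor
    · rintro ⟨i, hi, rfl⟩
      exact hi
    · intro ha
      exact ⟨⟨a, ((Nat.div_lt_iff_lt_mul hh).1 (by omega)).trans_le hle⟩, ha, rfl⟩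
  rw [← Finset.card_map Fin.valEmbedding, hmap, Nat.card_Ico, add_mul, one_mul,
    Nat.add_sub_cancel_left]

/-- The indicators of disjoint blocks of length `h` form a `2 * h`-equilateral set. -/
lemma div_le_equilateralDim {n h : ℕ} (hh : 0 < h) (hn : h ≤ n) :
    n / h ≤ equilateralDim (2 * h) n := by
  classical
  let x : ℕ → Fin n → Bool := fun j i => decide (i.val / h = j)
  have hdist {j k : ℕ} (hj : j < n / h) (hk : k < n / h) (hjk : j ≠ k) :
      hammingDist (x j) (x k) = 2 * h := by
    have hunion : (Finset.univ.filter fun i => x j i ≠ x k i) =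
        (Finset.univ.filter fun i : Fin n => i.val / h = j) ∪
          Finset.univ.filter fun i : Fin n => i.val / h = k := by
      ext i
      simp only [x, Finset.mem_filter, Finset.mem_univ, true_and, Finset.mem_union, ne_eq,
        decide_eq_decide]
      omega
    rw [hammingDist, hunion, Finset.card_union_of_disjoint, card_filter_div_eq hh hj,
      card_filter_div_eq hh hk, two_mul]
    refine Finset.disjoint_filter.2 fun i _ hi hi' => hjk (hi.symm.trans hi')
  have hinj : Set.InjOn x (Finset.range (n / h)) := by
    intro j hj k hk hxx
    by_contra hjk
    have := hdist (Finset.mem_range.1 hj) (Finset.mem_range.1 hk) hjk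
    rw [hxx, hammingDist_self] at this
    omega
  have hS : IsEquilateralSet (2 * h) ((Finset.range (n / h)).image x) := by
    refine ⟨⟨x 0, Finset.mem_image_of_mem x (Finset.mem_range.2 (Nat.div_pos hn hh))⟩, ?_⟩
    intro a ha b hb hab
    obtain ⟨j, hj, rfl⟩ := Finset.mem_image.1 ha
    obtain ⟨k, hk, rfl⟩ := Finset.mem_image.1 hb
    exact hdist (Finset.mem_range.1 hj) (Finset.mem_range.1 hk) fun h => hab (h ▸ rfl)
  simpa [Finset.card_image_of_injOn hinj] using hS.card_le_equilateralDim (by omega)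

/-- For `0 < α ≤ 1`, every natural number is of the form `⌊n ^ α⌋`. -/
lemma exists_floor_rpow_eq {α : ℝ} (h1 : 0 < α) (h2 : α ≤ 1) (k : ℕ) :
    ∃ n : ℕ, ⌊(n : ℝ) ^ α⌋₊ = k := by
  have hk : (0 : ℝ) ≤ k := k.cast_nonneg
  refine ⟨⌈(k : ℝ) ^ α⁻¹⌉₊, (Nat.floor_eq_iff (by positivity)).2 ⟨?_, ?_⟩⟩
  · rw [← Real.rpow_inv_le_iff_of_pos hk (by positivity) h1]
    exact Nat.le_ceil _
  · rw [← Real.lt_rpow_inv_iff_of_pos (by positivity) (by positivity) h1]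
    have hadd := Real.add_rpow_le_rpow_add hk zero_le_one ((one_le_inv₀ h1).2 h2)
    rw [Real.one_rpow] at hadd
    exact (Nat.ceil_lt_add_one (by positivity)).trans_le hadd

lemma frequently_even_floor_rpow {α : ℝ} (h1 : 0 < α) (h2 : α ≤ 1) :
    ∃ᶠ n : ℕ in atTop, Even ⌊(n : ℝ) ^ α⌋₊ := by
  rw [frequently_atTop]
  intro N
  obtain ⟨n, hn⟩ := exists_floor_rpow_eq h1 h2 (2 * (N + 1))
  refine ⟨n, ?_, hn ▸ even_two_mul _⟩
  by_contra! hlt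
  have : ⌊(n : ℝ) ^ α⌋₊ ≤ ⌊(N : ℝ) ^ α⌋₊ := by gcongr
  have hN : ⌊(N : ℝ) ^ α⌋₊ ≤ N := by
    refine Nat.floor_le_of_le ?_
    have hN1 : (1 : ℝ) ≤ N := by exact_mod_cast (by omega : 1 ≤ N)
    simpa using Real.rpow_le_rpow_of_exponent_le hN1 h2
  omega

lemma floor_rpow_pos {α : ℝ} (h1 : 0 ≤ α) {n : ℕ} (hn : 1 ≤ n) : 0 < ⌊(n : ℝ) ^ α⌋₊ :=
  Nat.floor_pos.2 (Real.one_le_rpow (by exact_mod_cast hn) h1)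

lemma log_equilateralDim_div_log_le {α : ℝ} (h1 : 0 ≤ α) {n : ℕ} (hn : 2 ≤ n) :
    Real.log (equilateralDim ⌊(n : ℝ) ^ α⌋₊ n) / Real.log n ≤ 2 := by
  have hn' : (2 : ℝ) ≤ n := by exact_mod_cast hn
  rw [div_le_iff₀ (Real.log_pos (by linarith))]
  rcases Nat.eq_zero_or_pos (equilateralDim ⌊(n : ℝ) ^ α⌋₊ n) with h0 | hpos
  · rw [h0, Nat.cast_zero, Real.log_zero]
    have := Real.log_nonneg (by linarith : (1 : ℝ) ≤ n)
    positivity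
  · have hle : (equilateralDim ⌊(n : ℝ) ^ α⌋₊ n : ℝ) ≤ n + 1 := by
      exact_mod_cast equilateralDim_le (floor_rpow_pos h1 (by omega))
    calc Real.log (equilateralDim ⌊(n : ℝ) ^ α⌋₊ n) ≤ Real.log ((n : ℝ) ^ 2) :=
          Real.log_le_log (by exact_mod_cast hpos) (by nlinarith)
      _ = 2 * Real.log n := by rw [Real.log_pow]; norm_num

lemma rpow_one_sub_le_equilateralDim {α : ℝ} (h1 : 0 ≤ α) (h2 : α ≤ 1) {n : ℕ} (hn : 1 ≤ n)
    (heven : Even ⌊(n : ℝ) ^ α⌋₊) :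
    (n : ℝ) ^ (1 - α) ≤ equilateralDim ⌊(n : ℝ) ^ α⌋₊ n := by
  have hn1 : (1 : ℝ) ≤ n := by exact_mod_cast hn
  have hd := floor_rpow_pos h1 hn
  have hfloor : (⌊(n : ℝ) ^ α⌋₊ : ℝ) ≤ (n : ℝ) ^ α := Nat.floor_le (by positivity)
  obtain ⟨h, hh⟩ := even_iff_two_dvd.1 heven
  rw [hh] at hd hfloor ⊢
  have hdn : 2 * h ≤ n := by
    have hpow := Real.rpow_le_rpow_of_exponent_le hn1 h2
    rw [Real.rpow_one] at hpow
    exact_mod_cast hfloor.trans hpow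
  have hle : n / h ≤ equilateralDim (2 * h) n := div_le_equilateralDim (by omega) (by omega)
  have hnle : n ≤ equilateralDim (2 * h) n * (2 * h) := by
    have hpos : 0 < n / h := Nat.div_pos (by omega) (by omega)
    have hlt : n < h * (n / h + 1) := Nat.lt_mul_div_succ n (by omega)
    nlinarith
  rw [Real.rpow_sub (by linarith), Real.rpow_one, div_le_iff₀ (by positivity)]
  calc (n : ℝ) ≤ equilateralDim (2 * h) n * (2 * h : ℕ) := by exact_mod_cast hnle
    _ ≤ equilateralDim (2 * h) n * (n : ℝ) ^ α := by gcongr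

theorem limsup_equilateralDim_pow_ge (α : ℝ) (h1 : 0 < α) (h2 : α < 1) :
    1 - α ≤ limsup (fun n : ℕ =>
        Real.log (equilateralDim ⌊(n : ℝ) ^ α⌋₊ n) / Real.log n) atTop := by
  refine le_limsup_of_frequently_le ?_ ?_
  · refine ((frequently_even_floor_rpow h1 h2.le).and_eventually (eventually_ge_atTop 2)).mono ?_
    rintro n ⟨heven, hn⟩
    have hn' : (2 : ℝ) ≤ n := by exact_mod_cast hn
    rw [le_div_iff₀ (Real.log_pos (by linarith)), ← Real.log_rpow (by linarith)]
    exact Real.log_le_log (by positivity)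
      (rpow_one_sub_le_equilateralDim h1.le h2.le (by omega) heven)
  · exact isBoundedUnder_of_eventually_le
      ((eventually_ge_atTop 2).mono fun _ hn => log_equilateralDim_div_log_le h1.le hn)
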